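/- arXiv:1904.03360 — 10 statements merged into one kernel-verified Lean document; each statement's English description precedes it below -/
import Mathlib

section
/- Let θ ∈ (0, π/2), a = tan θ, and E₀' > 0, and let H(u, λ) = (1 − u)²(u − λ − 2λE₀') − a²u²(1 − u + 2λE₀'). Then there exist λ₀ > 0, δ > 0, and a continuously differentiable function u : (−λ₀, λ₀) → ℝ such that u(0) = cos²θ, H(u(λ), λ) = 0 for all λ ∈ (−λ₀, λ₀), and for each λ ∈ (−λ₀, λ₀) the value u(λ) is the unique root of H(·, λ) in the interval (cos²θ − δ, cos²θ + δ). -/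
open Filter Topology in
/-- A scalar implicit function theorem, with the branch defined on a symmetric interval and unique
among all zeros in a fixed box. -/
lemma exists_contDiffOn_unique_zero_branch {f : ℝ × ℝ → ℝ} {x₀ y₀ d : ℝ}
    (hf : ContDiffAt ℝ 1 f (x₀, y₀)) (hzero : f (x₀, y₀) = 0)
    (hderiv : HasDerivAt (fun y => f (x₀, y)) d y₀) (hd : d ≠ 0) :
    ∃ r > (0 : ℝ), ∃ δ > (0 : ℝ), ∃ u : ℝ → ℝ,
      ContDiffOn ℝ 1 u (Set.Ioo (x₀ - r) (x₀ + r)) ∧ u x₀ = y₀ ∧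
      ∀ x ∈ Set.Ioo (x₀ - r) (x₀ + r),
        f (x, u x) = 0 ∧ u x ∈ Set.Ioo (y₀ - δ) (y₀ + δ) ∧
        ∀ y ∈ Set.Ioo (y₀ - δ) (y₀ + δ), f (x, y) = 0 → y = u x := by
  have hpartial : (fderiv ℝ f (x₀, y₀) ∘L .inr ℝ ℝ ℝ) 1 = d := by
    have hcomp := (hf.differentiableAt one_ne_zero).hasFDerivAt.comp_hasDerivAt y₀
      ((hasDerivAt_const y₀ x₀).prodMk (hasDerivAt_id y₀))
    simpa using hcomp.unique hderiv
  have hinv : (fderiv ℝ f (x₀, y₀) ∘L .inr ℝ ℝ ℝ).IsInvertible := by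
    refine ⟨ContinuousLinearEquiv.unitsEquivAut ℝ (Units.mk0 d hd), ?_⟩
    ext
    simpa using hpartial.symm
  set u := hf.implicitFunction one_ne_zero hinv
  have hu₀ : u x₀ = y₀ := hf.implicitFunction_apply_self one_ne_zero hinv
  have hu : ContDiffAt ℝ 1 u x₀ := hf.contDiffAt_implicitFunction one_ne_zero hinv
  have hroot : ∀ᶠ x in 𝓝 x₀, f (x, u x) = f (x₀, y₀) :=
    hf.eventually_apply_implicitFunction one_ne_zero hinv
  have huniq : ∀ᶠ p : ℝ × ℝ in 𝓝 (x₀, y₀), f p = f (x₀, y₀) ↔ u p.1 = p.2 :=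
    hf.eventually_apply_eq_iff_implicitFunction one_ne_zero hinv
  obtain ⟨δ, hδ, hball⟩ := Metric.eventually_nhds_iff_ball.mp huniq
  have hnear : ∀ᶠ x in 𝓝 x₀, u x ∈ Metric.ball y₀ δ :=
    hu.continuousAt.eventually_mem (hu₀ ▸ Metric.ball_mem_nhds y₀ hδ)
  obtain ⟨r, hr, hbr⟩ := Metric.eventually_nhds_iff_ball.mp
    ((((hu.eventually (by simp)).and hroot).and hnear).and (Metric.ball_mem_nhds x₀ hδ))
  simp only [Real.ball_eq_Ioo] at hbr
  refine ⟨r, hr, δ, hδ, u, fun x hx => (hbr x hx).1.1.1.contDiffWithinAt, hu₀, fun x hx => ?_⟩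
  obtain ⟨⟨⟨-, hfx⟩, hux⟩, hxδ⟩ := hbr x hx
  refine ⟨hfx.trans hzero, hux, fun y hy hfy => ?_⟩
  refine ((hball (x, y) ?_).mp (hfy.trans hzero.symm)).symm
  rw [← ball_prod_same]
  exact ⟨hxδ, Real.ball_eq_Ioo y₀ δ ▸ hy⟩


/-- (implicit function theorem for the shock polar) With `θ ∈ (0, π/2)`,
`a = tan θ`, `E₀' > 0`, and `H(u, λ) = (1 − u)²(u − λ − 2λE₀') − a²u²(1 − u + 2λE₀')`,
there exist `λ₀ > 0`, `δ > 0`, and a `C¹` function `u : (−λ₀, λ₀) → ℝ` with `u(0) = cos²θ`,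
`H(u(λ), λ) = 0` on `(−λ₀, λ₀)`, and for each `λ ∈ (−λ₀, λ₀)` the value `u(λ)` is the unique
root of `H(·, λ)` in `(cos²θ − δ, cos²θ + δ)`. -/
theorem hypersonic_wedge_implicit_branch
    (θ a E₀' : ℝ) (hθ : θ ∈ Set.Ioo 0 (Real.pi / 2)) (ha : a = Real.tan θ) (hE : 0 < E₀')
    (H : ℝ → ℝ → ℝ)
    (hH : ∀ u lam : ℝ,
      H u lam = (1 - u) ^ 2 * (u - lam - 2 * lam * E₀')
        - a ^ 2 * u ^ 2 * (1 - u + 2 * lam * E₀')) :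
    ∃ lam₀ > (0 : ℝ), ∃ δ > (0 : ℝ), ∃ u : ℝ → ℝ,
      ContDiffOn ℝ 1 u (Set.Ioo (-lam₀) lam₀) ∧
      u 0 = Real.cos θ ^ 2 ∧
      (∀ lam ∈ Set.Ioo (-lam₀) lam₀, H (u lam) lam = 0) ∧
      (∀ lam ∈ Set.Ioo (-lam₀) lam₀,
        u lam ∈ Set.Ioo (Real.cos θ ^ 2 - δ) (Real.cos θ ^ 2 + δ) ∧
        ∀ w ∈ Set.Ioo (Real.cos θ ^ 2 - δ) (Real.cos θ ^ 2 + δ), H w lam = 0 → w = u lam) := by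
  set c := Real.cos θ ^ 2 with hc
  have hcos : 0 < Real.cos θ :=
    Real.cos_pos_of_mem_Ioo ⟨by linarith [hθ.1, Real.pi_pos], hθ.2⟩
  have hsin : 0 < Real.sin θ := Real.sin_pos_of_pos_of_lt_pi hθ.1 (by linarith [hθ.2, Real.pi_pos])
  have hac : a ^ 2 * c = 1 - c := by
    rw [ha, hc, ← mul_pow, Real.tan_mul_cos hcos.ne', Real.sin_sq]
  have hc1 : 1 - c ≠ 0 := by
    rw [hc, ← Real.sin_sq]
    positivity
  have hzero : H c 0 = 0 := by
    rw [hH]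
    linear_combination (-c * (1 - c)) * hac
  have hderiv : HasDerivAt (fun u => H u 0) (-(1 - c)) c := by
    have hfactor : (fun u => H u 0) = fun u => u * (1 - u) * (1 - u - a ^ 2 * u) := by
      funext u
      rw [hH]
      ring
    have hid := hasDerivAt_id' c
    rw [hfactor]
    refine ((hid.mul (hid.const_sub 1)).mul
      ((hid.const_sub 1).sub (hid.const_mul (a ^ 2)))).congr_deriv ?_
    simp only [Pi.mul_apply, Pi.sub_apply]
    linear_combination (3 * c - 2) * hac
  have hsmooth : ContDiffAt ℝ 1 (fun p : ℝ × ℝ => H p.2 p.1) (0, c) := by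
    simp only [hH]
    fun_prop
  obtain ⟨r, hr, δ, hδ, u, hu, hu₀, hbranch⟩ :=
    exists_contDiffOn_unique_zero_branch hsmooth hzero hderiv (neg_ne_zero.mpr hc1)
  simp only [zero_sub, zero_add] at hu hbranch
  exact ⟨r, hr, δ, hδ, u, hu, hu₀, fun x hx => (hbranch x hx).1, fun x hx => (hbranch x hx).2⟩
end

section
/- Let θ ∈ (0, π/2), a = tan θ, E₀' > 0, and let u : (−λ₀, λ₀) → ℝ be the continuously differentiable local solution branch of H(u, λ) = 0 with u(0) = cos²θ. Define u₁(ε) = u(ε/(ε+2)) for ε near 0. Then ε ↦ u₁(ε) is differentiable at ε = 0 with derivative −(E₀' + (1/2)sin²θ); equivalently, u₁(ε) = cos²θ − (E₀' + (1/2)sin²θ)ε + o(ε) as ε → 0. -/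
/-- With `θ ∈ (0, π/2)`, `a = tan θ`, `E₀' > 0`, and `u : (−λ₀, λ₀) → ℝ` the `C¹`
local solution branch of `H(u, λ) = 0` with `u(0) = cos²θ`, the function
`u₁(ε) = u(ε/(ε+2))` is differentiable at `ε = 0` with derivative `−(E₀' + (1/2) sin²θ)`. -/
theorem hypersonic_wedge_u1_derivative
    (θ a E₀' lam₀ : ℝ) (hθ : θ ∈ Set.Ioo 0 (Real.pi / 2)) (ha : a = Real.tan θ)
    (hE : 0 < E₀') (hlam₀ : 0 < lam₀)
    (u : ℝ → ℝ) (hu : ContDiffOn ℝ 1 u (Set.Ioo (-lam₀) lam₀))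
    (hu0 : u 0 = Real.cos θ ^ 2)
    (huH : ∀ lam ∈ Set.Ioo (-lam₀) lam₀,
      (1 - u lam) ^ 2 * (u lam - lam - 2 * lam * E₀')
        - a ^ 2 * (u lam) ^ 2 * (1 - u lam + 2 * lam * E₀') = 0) :
    HasDerivAt (fun ε : ℝ => u (ε / (ε + 2))) (-(E₀' + (1 / 2) * Real.sin θ ^ 2)) 0 := by
  obtain ⟨hθ0, hθ1⟩ := hθ
  have hc : 0 < Real.cos θ := Real.cos_pos_of_mem_Ioo ⟨by linarith, hθ1⟩
  have hs : 0 < Real.sin θ := Real.sin_pos_of_pos_of_lt_pi hθ0 (by linarith)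
  have hcs : Real.cos θ ^ 2 = 1 - Real.sin θ ^ 2 := Real.cos_sq' θ
  have hac : a ^ 2 * Real.cos θ ^ 2 = Real.sin θ ^ 2 := by
    rw [ha, Real.tan_eq_sin_div_cos]
    field_simp
  have hmem : Set.Ioo (-lam₀) lam₀ ∈ nhds (0 : ℝ) := Ioo_mem_nhds (by linarith) hlam₀
  have hd : HasDerivAt u (deriv u 0) 0 :=
    ((hu.contDiffAt hmem).differentiableAt one_ne_zero).hasDerivAt
  set d := deriv u 0
  have hid := hasDerivAt_id (0 : ℝ)
  have hH := (((hd.const_sub 1).pow 2).mul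
    ((hd.sub hid).sub ((hid.const_mul 2).mul_const E₀'))).sub
    (((hd.pow 2).const_mul (a ^ 2)).mul
      ((hd.const_sub 1).add ((hid.const_mul 2).mul_const E₀')))
  have hzero := hH.unique ((hasDerivAt_const (0 : ℝ) (0 : ℝ)).congr_of_eventuallyEq
    (Filter.mem_of_superset hmem fun lam hlam => huH lam hlam))
  simp only [Nat.cast_ofNat, hu0, Nat.add_one_sub_one, pow_one, mul_neg, id_eq, Pi.sub_apply,
    sub_zero, mul_zero, zero_mul, neg_mul, Pi.pow_apply, mul_one, Pi.add_apply, add_zero] at hzero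
  have hd_eq : d = -(Real.sin θ ^ 2 + 2 * E₀') := by
    have hs2 : Real.sin θ ^ 2 ≠ 0 := by positivity
    apply mul_left_cancel₀ hs2
    generalize Real.cos θ ^ 2 = c at *
    generalize Real.sin θ ^ 2 = s at *
    subst hcs
    linear_combination -hzero - (2 * s * d + (1 - s) * (-d + 2 * E₀')) * hac
  have hq : HasDerivAt (fun ε : ℝ => ε / (ε + 2)) (1 / 2) 0 :=
    (hid.div (hid.add_const 2) (by norm_num)).congr_deriv (by norm_num)
  have hd' : HasDerivAt u d ((0 : ℝ) / (0 + 2)) := by simpa using hd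
  refine (hd'.comp 0 hq).congr_deriv ?_
  rw [hd_eq]
  ring
end

section
/- Newton's sine-squared pressure law: let θ ∈ (0, π/2), a = tan θ, E₀' > 0, and for small ε > 0 define α^ε = arctan((1 − u₁^ε)/(a·u₁^ε)) with u₁^ε = u(ε/(ε+2)) the shock-polar root, and the downstream pressure p₁^ε = (2(ε+1)sin²α^ε − ε²E₀')/((ε+1)(ε+2)). Then lim_{ε→0⁺} p₁^ε = sin²θ. -/
open Filter Topology

/-- Newton's sine-squared pressure law. With `θ ∈ (0, π/2)`, `a = tan θ`,
`E₀' > 0`, `u₁^ε = u(ε/(ε+2))` the shock-polar root, `α^ε = arctan((1 − u₁^ε)/(a·u₁^ε))`, and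
`p₁^ε = (2(ε+1)sin²α^ε − ε²E₀')/((ε+1)(ε+2))`, one has `p₁^ε → sin²θ` as `ε → 0⁺`. -/
theorem hypersonic_wedge_newton_pressure_law
    (θ a E₀' lam₀ : ℝ) (hθ : θ ∈ Set.Ioo 0 (Real.pi / 2)) (ha : a = Real.tan θ)
    (hE : 0 < E₀') (hlam₀ : 0 < lam₀)
    (u : ℝ → ℝ) (hu : ContDiffOn ℝ 1 u (Set.Ioo (-lam₀) lam₀))
    (hu0 : u 0 = Real.cos θ ^ 2)
    (huH : ∀ lam ∈ Set.Ioo (-lam₀) lam₀,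
      (1 - u lam) ^ 2 * (u lam - lam - 2 * lam * E₀')
        - a ^ 2 * (u lam) ^ 2 * (1 - u lam + 2 * lam * E₀') = 0) :
    Tendsto
      (fun ε : ℝ =>
        (2 * (ε + 1) *
            Real.sin (Real.arctan ((1 - u (ε / (ε + 2))) / (a * u (ε / (ε + 2))))) ^ 2
          - ε ^ 2 * E₀') / ((ε + 1) * (ε + 2)))
      (𝓝[>] 0) (𝓝 (Real.sin θ ^ 2)) := by
  obtain ⟨hθ0, hθ1⟩ := hθ
  have hcos : 0 < Real.cos θ := Real.cos_pos_of_mem_Ioo ⟨by linarith, hθ1⟩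
  have htan : 0 < a := ha ▸ Real.tan_pos_of_pos_of_lt_pi_div_two hθ0 hθ1
  have hratio : (1 - u 0) / (a * u 0) = Real.tan θ := by
    rw [hu0, ha, Real.tan_eq_sin_div_cos, ← Real.sin_sq]
    field_simp
  have hu_zero : ContinuousAt u 0 :=
    hu.continuousOn.continuousAt (Ioo_mem_nhds (by linarith) hlam₀)
  have hlam : ContinuousAt (fun ε : ℝ => ε / (ε + 2)) 0 :=
    continuousAt_id.div (by fun_prop) (by norm_num)
  have hroot : ContinuousAt (fun ε : ℝ => u (ε / (ε + 2))) 0 :=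
    ContinuousAt.comp (g := u) (by simpa using hu_zero) hlam
  have hslope : ContinuousAt
      (fun ε : ℝ => (1 - u (ε / (ε + 2))) / (a * u (ε / (ε + 2)))) 0 := by
    refine (continuousAt_const.sub hroot).div (continuousAt_const.mul hroot) ?_
    rw [zero_div, hu0]
    positivity
  have hsin_arctan := (Real.continuous_sin.comp Real.continuous_arctan).continuousAt.comp hslope
  have hpressure : ContinuousAt (fun ε : ℝ =>
      (2 * (ε + 1) *
          Real.sin (Real.arctan ((1 - u (ε / (ε + 2))) / (a * u (ε / (ε + 2))))) ^ 2
        - ε ^ 2 * E₀') / ((ε + 1) * (ε + 2))) 0 := by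
    refine ContinuousAt.div (ContinuousAt.sub (ContinuousAt.mul (by fun_prop)
      (hsin_arctan.pow 2)) (by fun_prop)) (by fun_prop) (by norm_num)
  have hlim := hpressure.tendsto.mono_left (nhdsWithin_le_nhds (s := Set.Ioi 0))
  convert hlim using 2
  rw [zero_div, hratio, Real.arctan_tan (by linarith) hθ1]
  ring
end

section
/- Let θ ∈ (0, π/2), a = tan θ, E₀' > 0, and for small ε > 0 define α^ε = arctan((1 − u₁^ε)/(a·u₁^ε)) with u₁^ε = u(ε/(ε+2)) the shock-polar root, and the downstream density ρ₁^ε = ((ε+2)/ε)·sin²α^ε/(2E₀' + sin²α^ε). Then lim_{ε→0⁺} ε·ρ₁^ε = 2sin²θ/(2E₀' + sin²θ); in particular ρ₁^ε blows up at rate 1/ε as ε → 0⁺. -/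
open Filter Topology

/-- With `θ ∈ (0, π/2)`, `a = tan θ`, `E₀' > 0`, `u₁^ε = u(ε/(ε+2))` the
shock-polar root, `α^ε = arctan((1 − u₁^ε)/(a·u₁^ε))`, and the downstream density
`ρ₁^ε = ((ε+2)/ε)·sin²α^ε/(2E₀' + sin²α^ε)`, one has
`ε·ρ₁^ε → 2 sin²θ/(2E₀' + sin²θ)` as `ε → 0⁺` (so `ρ₁^ε` blows up at rate `1/ε`). -/
theorem hypersonic_wedge_density_blowup
    (θ a E₀' lam₀ : ℝ) (hθ : θ ∈ Set.Ioo 0 (Real.pi / 2)) (ha : a = Real.tan θ)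
    (hE : 0 < E₀') (hlam₀ : 0 < lam₀)
    (u : ℝ → ℝ) (hu : ContDiffOn ℝ 1 u (Set.Ioo (-lam₀) lam₀))
    (hu0 : u 0 = Real.cos θ ^ 2)
    (huH : ∀ lam ∈ Set.Ioo (-lam₀) lam₀,
      (1 - u lam) ^ 2 * (u lam - lam - 2 * lam * E₀')
        - a ^ 2 * (u lam) ^ 2 * (1 - u lam + 2 * lam * E₀') = 0) :
    Tendsto
      (fun ε : ℝ =>
        ε * (((ε + 2) / ε) *
            Real.sin (Real.arctan ((1 - u (ε / (ε + 2))) / (a * u (ε / (ε + 2))))) ^ 2 /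
          (2 * E₀' +
            Real.sin (Real.arctan ((1 - u (ε / (ε + 2))) / (a * u (ε / (ε + 2))))) ^ 2)))
      (𝓝[>] 0) (𝓝 (2 * Real.sin θ ^ 2 / (2 * E₀' + Real.sin θ ^ 2))) := by
  obtain ⟨hθ0, hθ1⟩ := hθ
  have hcos : 0 < Real.cos θ := Real.cos_pos_of_mem_Ioo ⟨by linarith, hθ1⟩
  have hsin : 0 < Real.sin θ := Real.sin_pos_of_pos_of_lt_pi hθ0 (by linarith)
  have hlam : Tendsto (fun ε : ℝ => ε / (ε + 2)) (𝓝 0) (𝓝 0) := by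
    have h : ContinuousAt (fun ε : ℝ => ε / (ε + 2)) 0 :=
      continuousAt_id.div (by fun_prop) (by norm_num)
    simpa [ContinuousAt] using h
  have hu_cont : Tendsto u (𝓝 0) (𝓝 (Real.cos θ ^ 2)) := by
    rw [← hu0]
    exact hu.continuousOn.continuousAt (Ioo_mem_nhds (by linarith) hlam₀)
  have hu_lim := hu_cont.comp hlam
  have ha_cos : a * Real.cos θ ^ 2 ≠ 0 := by
    rw [ha]
    exact (mul_pos (Real.tan_pos_of_pos_of_lt_pi_div_two hθ0 hθ1) (pow_pos hcos 2)).ne'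
  have hslope : (1 - Real.cos θ ^ 2) / (a * Real.cos θ ^ 2) = Real.tan θ := by
    rw [← Real.sin_sq, ha, Real.tan_eq_sin_div_cos]
    field_simp
  have hangle : Tendsto
      (fun ε : ℝ => Real.sin
        (Real.arctan ((1 - u (ε / (ε + 2))) / (a * u (ε / (ε + 2))))) ^ 2)
      (𝓝 0) (𝓝 (Real.sin θ ^ 2)) := by
    have h := (hu_lim.const_sub 1).div (hu_lim.const_mul a) ha_cos
    rw [hslope] at h
    have h' := (Real.continuous_sin.comp Real.continuous_arctan).continuousAt.tendsto.comp h
    simp only [Function.comp_apply, Real.arctan_tan (by linarith : -(Real.pi / 2) < θ) hθ1] at h'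
    exact h'.pow 2
  have hε : Tendsto (fun ε : ℝ => ε + 2) (𝓝 0) (𝓝 2) := by
    simpa using (tendsto_id (x := 𝓝 (0 : ℝ))).add_const 2
  have hlim := (hε.mul hangle).div (hangle.const_add (2 * E₀')) (by positivity)
  refine (hlim.mono_left nhdsWithin_le_nhds).congr' ?_
  filter_upwards [self_mem_nhdsWithin] with ε hpos
  have hne : ε ≠ 0 := ne_of_gt hpos
  simp only [Pi.div_apply]
  rw [← mul_div_assoc, ← mul_assoc, mul_div_cancel₀ _ hne]
end

section
/- Let θ ∈ (0, π/2), a = tan θ, E₀' > 0, and for small ε > 0 let σ^ε = (1 − u₁^ε)/(a·u₁^ε) with u₁^ε = u(ε/(ε+2)) the shock-polar root. Then lim_{ε→0⁺} (σ^ε − a)/ε = ((1/2)sin²θ + E₀')/(cos³θ · sin θ); equivalently σ^ε − a = ((1/2)sin²θ + E₀')·ε/(cos³θ sin θ) + o(ε) as ε → 0⁺. -/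
open Filter Topology

/-- With `θ ∈ (0, π/2)`, `a = tan θ`, `E₀' > 0`, `u₁^ε = u(ε/(ε+2))` the
shock-polar root, and `σ^ε = (1 − u₁^ε)/(a·u₁^ε)`, one has
`(σ^ε − a)/ε → ((1/2)sin²θ + E₀')/(cos³θ·sin θ)` as `ε → 0⁺`; i.e.
`σ^ε − a = ((1/2)sin²θ + E₀')ε/(cos³θ sin θ) + o(ε)`. -/
theorem hypersonic_wedge_shock_angle_rate
    (θ a E₀' lam₀ : ℝ) (hθ : θ ∈ Set.Ioo 0 (Real.pi / 2)) (ha : a = Real.tan θ)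
    (hE : 0 < E₀') (hlam₀ : 0 < lam₀)
    (u : ℝ → ℝ) (hu : ContDiffOn ℝ 1 u (Set.Ioo (-lam₀) lam₀))
    (hu0 : u 0 = Real.cos θ ^ 2)
    (huH : ∀ lam ∈ Set.Ioo (-lam₀) lam₀,
      (1 - u lam) ^ 2 * (u lam - lam - 2 * lam * E₀')
        - a ^ 2 * (u lam) ^ 2 * (1 - u lam + 2 * lam * E₀') = 0) :
    Tendsto
      (fun ε : ℝ => ((1 - u (ε / (ε + 2))) / (a * u (ε / (ε + 2))) - a) / ε)
      (𝓝[>] 0)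
      (𝓝 (((1 / 2) * Real.sin θ ^ 2 + E₀') / (Real.cos θ ^ 3 * Real.sin θ))) := by
  have hs : 0 < Real.sin θ := Real.sin_pos_of_pos_of_lt_pi hθ.1 (by linarith [hθ.2, Real.pi_pos])
  have hc : 0 < Real.cos θ := Real.cos_pos_of_mem_Ioo ⟨by linarith [hθ.1, Real.pi_pos], hθ.2⟩
  have hsc : Real.cos θ ^ 2 = 1 - Real.sin θ ^ 2 := Real.cos_sq' θ
  rw [Real.tan_eq_sin_div_cos] at ha
  have hac : a * Real.cos θ = Real.sin θ := by rw [ha]; field_simp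
  have ha0 : a ≠ 0 := by rw [ha]; positivity
  have hmem : Set.Ioo (-lam₀) lam₀ ∈ 𝓝 (0 : ℝ) := Ioo_mem_nhds (by linarith) hlam₀
  have hud : HasDerivAt u (deriv u 0) 0 :=
    ((hu.contDiffAt hmem).differentiableAt (by norm_num)).hasDerivAt
  generalize deriv u 0 = d at hud
  -- Differentiating the shock-polar equation at `0` determines the derivative of `u` there.
  have hd : d = -(Real.sin θ ^ 2 + 2 * E₀') := by
    have hid := hasDerivAt_id (0 : ℝ)
    have hH := (((hud.const_sub 1).pow 2).mul
      ((hud.sub hid).sub ((hid.const_mul 2).mul_const E₀'))).sub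
      (((hud.pow 2).const_mul (a ^ 2)).mul
        ((hud.const_sub 1).add ((hid.const_mul 2).mul_const E₀')))
    have hzero : HasDerivAt (fun _ : ℝ => (0 : ℝ)) _ 0 := hH.congr_of_eventuallyEq (by
      filter_upwards [hmem] with x hx
      simp only [Pi.mul_apply, Pi.add_apply, Pi.sub_apply, Pi.pow_apply, id]
      linear_combination -huH x hx)
    have h := hzero.unique (hasDerivAt_const (0 : ℝ) (0 : ℝ))
    simp only [Pi.add_apply, Pi.sub_apply, Pi.pow_apply, id, hu0] at h
    have ha2 : a ^ 2 * Real.cos θ ^ 2 = 1 - Real.cos θ ^ 2 := by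
      linear_combination (a * Real.cos θ + Real.sin θ) * hac + hsc
    have key : Real.sin θ ^ 2 * (d + (Real.sin θ ^ 2 + 2 * E₀')) = 0 := by
      rw [Real.sin_sq]
      norm_num at h
      linear_combination -h - (2 * d * (1 - Real.cos θ ^ 2)
        + Real.cos θ ^ 2 * (2 * E₀' - d)) * ha2
    rcases mul_eq_zero.1 key with h0 | h0
    · exact absurd h0 (by positivity)
    · linarith
  have hlam : HasDerivAt (fun ε : ℝ => ε / (ε + 2)) (1 / 2) 0 := by
    have := (hasDerivAt_id (0 : ℝ)).div ((hasDerivAt_id (0 : ℝ)).add_const 2) (by norm_num)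
    exact this.congr_deriv (by norm_num)
  have hcomp : HasDerivAt (fun ε : ℝ => u (ε / (ε + 2))) (d * (1 / 2)) 0 :=
    HasDerivAt.comp (0 : ℝ) (by simpa using hud) hlam
  have hσ := (hcomp.const_sub 1).div (hcomp.const_mul a) (by simp [hu0, ha0, hc.ne'])
  have hlim := hσ.tendsto_slope_zero_right
  convert hlim using 2 with ε
  · have h0 : (1 - Real.cos θ ^ 2) / (a * Real.cos θ ^ 2) = a := by
      rw [ha, ← Real.sin_sq]
      field_simp
    simp [hu0, h0]
    ring
  · simp only [zero_div, hu0, hd, ha]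
    field_simp
    ring_nf
end

section
/- Let θ ∈ (0, π/2), a = tan θ, E₀' > 0, and for small ε > 0 define u₁^ε = u(ε/(ε+2)) (the shock-polar root), σ^ε = (1 − u₁^ε)/(a·u₁^ε), α^ε = arctan σ^ε, and ρ₁^ε = ((ε+2)/ε)·sin²α^ε/(2E₀' + sin²α^ε). Then lim_{ε→0⁺} ρ₁^ε·(σ^ε − a) = sin θ / cos³θ. -/
open Filter Topology

/-- On the shock polar, the factor `(1 - v) - a² v` is proportional to `lam`, which gives the exact
deviation of the slope `(1 - v) / (a v)` from `a`. -/
theorem slope_sub_eq_of_shock_polar {a E lam v : ℝ} (ha : a ≠ 0) (hv : v ≠ 0) (hv1 : 1 - v ≠ 0)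
    (h : (1 - v) ^ 2 * (v - lam - 2 * lam * E) - a ^ 2 * v ^ 2 * (1 - v + 2 * lam * E) = 0) :
    (1 - v) / (a * v) - a =
      lam * (((1 + 2 * E) * (1 - v) ^ 2 + 2 * E * a ^ 2 * v ^ 2) / (a * v ^ 2 * (1 - v))) := by
  field_simp
  linear_combination h

/-- With `θ ∈ (0, π/2)`, `a = tan θ`, `E₀' > 0`, `u₁^ε = u(ε/(ε+2))` the
shock-polar root, `σ^ε = (1 − u₁^ε)/(a·u₁^ε)`, `α^ε = arctan σ^ε`, and
`ρ₁^ε = ((ε+2)/ε)·sin²α^ε/(2E₀' + sin²α^ε)`, one has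
`ρ₁^ε·(σ^ε − a) → sin θ/cos³θ` as `ε → 0⁺`. -/
theorem hypersonic_wedge_mass_concentration_rate
    (θ a E₀' lam₀ : ℝ) (hθ : θ ∈ Set.Ioo 0 (Real.pi / 2)) (ha : a = Real.tan θ)
    (hE : 0 < E₀') (hlam₀ : 0 < lam₀)
    (u : ℝ → ℝ) (hu : ContDiffOn ℝ 1 u (Set.Ioo (-lam₀) lam₀))
    (hu0 : u 0 = Real.cos θ ^ 2)
    (huH : ∀ lam ∈ Set.Ioo (-lam₀) lam₀,
      (1 - u lam) ^ 2 * (u lam - lam - 2 * lam * E₀')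
        - a ^ 2 * (u lam) ^ 2 * (1 - u lam + 2 * lam * E₀') = 0) :
    Tendsto
      (fun ε : ℝ =>
        (((ε + 2) / ε) *
            Real.sin (Real.arctan ((1 - u (ε / (ε + 2))) / (a * u (ε / (ε + 2))))) ^ 2 /
          (2 * E₀' +
            Real.sin (Real.arctan ((1 - u (ε / (ε + 2))) / (a * u (ε / (ε + 2))))) ^ 2)) *
        ((1 - u (ε / (ε + 2))) / (a * u (ε / (ε + 2))) - a))
      (𝓝[>] 0) (𝓝 (Real.sin θ / Real.cos θ ^ 3)) := by
  obtain ⟨h0, h1⟩ := hθ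
  have hc : 0 < Real.cos θ := Real.cos_pos_of_mem_Ioo ⟨by linarith, h1⟩
  have hs : 0 < Real.sin θ := Real.sin_pos_of_pos_of_lt_pi h0 (by linarith)
  have hsc := Real.sin_sq_add_cos_sq θ
  have ha' : a = Real.sin θ / Real.cos θ := ha.trans (Real.tan_eq_sin_div_cos θ)
  have ha0 : a ≠ 0 := by rw [ha']; positivity
  have hone : 1 - Real.cos θ ^ 2 = Real.sin θ ^ 2 := by linarith
  have hlam : Tendsto (fun ε : ℝ => ε / (ε + 2)) (𝓝[>] 0) (𝓝 0) := by
    have : ContinuousAt (fun ε : ℝ => ε / (ε + 2)) 0 :=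
      continuousAt_id.div (by fun_prop) (by norm_num)
    simpa using this.tendsto.mono_left nhdsWithin_le_nhds
  have hlamI : ∀ᶠ ε in 𝓝[>] (0 : ℝ), ε / (ε + 2) ∈ Set.Ioo (-lam₀) lam₀ :=
    hlam (Ioo_mem_nhds (by linarith) hlam₀)
  have hucont : ContinuousAt u 0 :=
    hu.continuousOn.continuousAt (Ioo_mem_nhds (by linarith) hlam₀)
  have hv : Tendsto (fun ε : ℝ => u (ε / (ε + 2))) (𝓝[>] 0) (𝓝 (Real.cos θ ^ 2)) := by
    rw [← hu0]
    exact hucont.tendsto.comp hlam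
  have hv0 : ∀ᶠ ε in 𝓝[>] (0 : ℝ), u (ε / (ε + 2)) ≠ 0 := hv.eventually_ne (by positivity)
  have hv1 : ∀ᶠ ε in 𝓝[>] (0 : ℝ), 1 - u (ε / (ε + 2)) ≠ 0 :=
    (hv.const_sub 1).eventually_ne (by rw [hone]; positivity)
  let F : ℝ → ℝ := fun v =>
    Real.sin (Real.arctan ((1 - v) / (a * v))) ^ 2 /
        (2 * E₀' + Real.sin (Real.arctan ((1 - v) / (a * v))) ^ 2) *
      (((1 + 2 * E₀') * (1 - v) ^ 2 + 2 * E₀' * a ^ 2 * v ^ 2) / (a * v ^ 2 * (1 - v)))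
  have hslope : ContinuousAt (fun v : ℝ => (1 - v) / (a * v)) (Real.cos θ ^ 2) :=
    ContinuousAt.div (by fun_prop) (by fun_prop) (by positivity)
  have hsin : ContinuousAt (fun v : ℝ => Real.sin (Real.arctan ((1 - v) / (a * v))) ^ 2)
      (Real.cos θ ^ 2) :=
    (Real.continuous_sin.continuousAt.comp
      (Real.continuous_arctan.continuousAt.comp hslope)).pow 2
  have hF : ContinuousAt F (Real.cos θ ^ 2) :=
    (hsin.div (continuousAt_const.add hsin)
        (add_pos_of_pos_of_nonneg (mul_pos two_pos hE) (sq_nonneg _)).ne').mul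
      (ContinuousAt.div (by fun_prop) (by fun_prop) (by rw [hone]; positivity))
  have hFval : F (Real.cos θ ^ 2) = Real.sin θ / Real.cos θ ^ 3 := by
    have hσ : (1 - Real.cos θ ^ 2) / (a * Real.cos θ ^ 2) = Real.tan θ := by
      rw [hone, ha', Real.tan_eq_sin_div_cos]
      field_simp
    have harctan : Real.arctan (Real.tan θ) = θ := Real.arctan_tan (by linarith) h1
    simp only [F]
    rw [hσ, harctan, hone, ha']
    field_simp
    linear_combination 2 * E₀' * hsc
  rw [← hFval]
  refine (hF.tendsto.comp hv).congr' ?_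
  filter_upwards [hlamI, hv0, hv1, self_mem_nhdsWithin] with ε hεI hε0 hε1 hεpos
  have hε : (0 : ℝ) < ε := hεpos
  have hε2 : ε + 2 ≠ 0 := by positivity
  rw [slope_sub_eq_of_shock_polar ha0 hε0 hε1 (huH _ hεI)]
  have hinv : (ε + 2) / ε * (ε / (ε + 2)) = 1 := by field_simp
  simp only [F, Function.comp_apply]
  rw [mul_div_assoc, mul_mul_mul_comm, hinv, one_mul]
end

section
/- Let θ ∈ (0, π/2), a = tan θ, E₀' > 0, and for small ε > 0 define the downstream pressure p₁^ε = (2(ε+1)sin²α^ε − ε²E₀')/((ε+1)(ε+2)) (with α^ε = arctan((1 − u₁^ε)/(a·u₁^ε)), u₁^ε = u(ε/(ε+2)) the shock-polar root) and the upstream pressure p₀^ε = (ε/(ε+1))·E₀'. Then there exists ε₀ > 0 such that for all ε ∈ (0, ε₀): 0 < u₁^ε < 1 and p₁^ε > p₀^ε (the entropy condition: pressure increases across the shock). -/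
/-- Entropy condition. With `θ ∈ (0, π/2)`, `a = tan θ`, `E₀' > 0`,
`u₁^ε = u(ε/(ε+2))` the shock-polar root, `α^ε = arctan((1 − u₁^ε)/(a·u₁^ε))`,
`p₁^ε = (2(ε+1)sin²α^ε − ε²E₀')/((ε+1)(ε+2))`, and `p₀^ε = (ε/(ε+1))E₀'`, there exists
`ε₀ > 0` such that for all `ε ∈ (0, ε₀)`: `0 < u₁^ε < 1` and `p₁^ε > p₀^ε`. -/
theorem hypersonic_wedge_entropy_condition
    (θ a E₀' lam₀ : ℝ) (hθ : θ ∈ Set.Ioo 0 (Real.pi / 2)) (ha : a = Real.tan θ)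
    (hE : 0 < E₀') (hlam₀ : 0 < lam₀)
    (u : ℝ → ℝ) (hu : ContDiffOn ℝ 1 u (Set.Ioo (-lam₀) lam₀))
    (hu0 : u 0 = Real.cos θ ^ 2)
    (huH : ∀ lam ∈ Set.Ioo (-lam₀) lam₀,
      (1 - u lam) ^ 2 * (u lam - lam - 2 * lam * E₀')
        - a ^ 2 * (u lam) ^ 2 * (1 - u lam + 2 * lam * E₀') = 0) :
    ∃ ε₀ > (0 : ℝ), ∀ ε : ℝ, 0 < ε → ε < ε₀ →
      0 < u (ε / (ε + 2)) ∧ u (ε / (ε + 2)) < 1 ∧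
      (2 * (ε + 1) *
          Real.sin (Real.arctan ((1 - u (ε / (ε + 2))) / (a * u (ε / (ε + 2))))) ^ 2
        - ε ^ 2 * E₀') / ((ε + 1) * (ε + 2)) > (ε / (ε + 1)) * E₀' := by
  obtain ⟨hθ0, hθ1⟩ := hθ
  have hcos : 0 < Real.cos θ := Real.cos_pos_of_mem_Ioo ⟨by linarith, hθ1⟩
  have hsin : 0 < Real.sin θ := Real.sin_pos_of_pos_of_lt_pi hθ0 (by linarith)
  have ha0 : 0 < a := ha ▸ Real.tan_pos_of_pos_of_lt_pi_div_two hθ0 hθ1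
  have hu0_pos : 0 < u 0 := by rw [hu0]; positivity
  have hu0_lt : u 0 < 1 := by
    rw [hu0]
    nlinarith [Real.sin_sq_add_cos_sq θ, pow_pos hsin 2]
  have hu_cont : ContinuousAt u 0 :=
    hu.continuousOn.continuousAt (Ioo_mem_nhds (by linarith) hlam₀)
  have hv_cont : ContinuousAt (fun ε : ℝ => u (ε / (ε + 2))) 0 := by
    refine ContinuousAt.comp (f := fun ε : ℝ => ε / (ε + 2)) (g := u) (by simpa using hu_cont) ?_
    exact continuousAt_id.div (by fun_prop) (by norm_num)
  have hv0 : u ((0 : ℝ) / (0 + 2)) = u 0 := by norm_num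
  have hα_cont : ContinuousAt (fun ε : ℝ =>
      (1 - u (ε / (ε + 2))) / (a * u (ε / (ε + 2)))) 0 := by
    refine (continuousAt_const.sub hv_cont).div (continuousAt_const.mul hv_cont) ?_
    rw [hv0]
    positivity
  have hsin_cont : ContinuousAt (fun ε : ℝ => Real.sin (Real.arctan
      ((1 - u (ε / (ε + 2))) / (a * u (ε / (ε + 2)))))) 0 :=
    Real.continuous_sin.continuousAt.comp (Real.continuous_arctan.continuousAt.comp hα_cont)
  have hp₁_cont : ContinuousAt (fun ε : ℝ => (2 * (ε + 1) *
      Real.sin (Real.arctan ((1 - u (ε / (ε + 2))) / (a * u (ε / (ε + 2))))) ^ 2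
        - ε ^ 2 * E₀') / ((ε + 1) * (ε + 2))) 0 := by
    refine ContinuousAt.div (ContinuousAt.sub ?_ (by fun_prop)) (by fun_prop) (by norm_num)
    exact ContinuousAt.mul (by fun_prop) (hsin_cont.pow 2)
  have hp₀_cont : ContinuousAt (fun ε : ℝ => (ε / (ε + 1)) * E₀') 0 :=
    (continuousAt_id.div (by fun_prop) (by norm_num)).mul continuousAt_const
  have hsin_pos : 0 < Real.sin (Real.arctan ((1 - u 0) / (a * u 0))) := by
    have hq : 0 < (1 - u 0) / (a * u 0) := div_pos (by linarith) (by positivity)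
    rw [Real.sin_arctan]
    positivity
  have h_pos := hv_cont.eventually_const_lt (u := 0) (by simpa using hu0_pos)
  have h_lt := hv_cont.eventually_lt_const (u := 1) (by simpa using hu0_lt)
  have h_entropy := hp₀_cont.eventually_lt hp₁_cont (by
    simp only [zero_div, zero_mul, zero_add]
    norm_num
    positivity)
  obtain ⟨ε₀, hε₀, h⟩ := Metric.eventually_nhds_iff.mp (h_pos.and (h_lt.and h_entropy))
  refine ⟨ε₀, hε₀, fun ε hε hε_lt => h ?_⟩
  rwa [Real.dist_eq, sub_zero, abs_of_pos hε]
end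

section
/- Weak form of y-momentum conservation for the limiting measure solution: let θ ∈ (0, π/2) and a = tan θ. Then for every continuously differentiable φ : ℝ² → ℝ with compact support, ∫₀^∞ [ (sin²θ cos θ)·x·∂ₓφ(x, ax) + (sin³θ)·x·∂_yφ(x, ax) + (sin²θ cos θ)·φ(x, ax) ] dx = 0. That is, the measures m² = (x sin²θ cos θ)·δ_W and n² = (x sin³θ)·δ_W satisfy ∂ₓm² + ∂_y n² = w_p²·δ_W with boundary weight w_p² = sin²θ cos θ. -/
open MeasureTheory

/-- Restricting a compactly supported function on the plane to the line of slope `a` gives a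
compactly supported function. -/
lemma hasCompactSupport_comp_line {φ : ℝ × ℝ → ℝ} (hφ : HasCompactSupport φ) (a : ℝ) :
    HasCompactSupport fun x : ℝ => φ (x, a * x) := by
  have hleft : Function.LeftInverse Prod.fst fun x : ℝ => (x, a * x) := fun _ => rfl
  exact hφ.comp_isClosedEmbedding (hleft.isClosedEmbedding continuous_fst (by fun_prop))

lemma hasDerivAt_comp_line {φ : ℝ × ℝ → ℝ} {a x : ℝ} (hφ : DifferentiableAt ℝ φ (x, a * x)) :
    HasDerivAt (fun t : ℝ => φ (t, a * t))
      (fderiv ℝ φ (x, a * x) (1, 0) + a * fderiv ℝ φ (x, a * x) (0, 1)) x := by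
  have hline : HasDerivAt (fun t : ℝ => (t, a * t)) (1, a) x := by
    simpa using (hasDerivAt_id x).prodMk ((hasDerivAt_id x).const_mul a)
  have hdir : ((1, a) : ℝ × ℝ) = (1, 0) + a • (0, 1) := by simp
  have h := hφ.hasFDerivAt.comp_hasDerivAt x hline
  rwa [hdir, map_add, map_smul, smul_eq_mul] at h

/-- Along the ray of slope `a`, the derivative of `x φ(x, a x)` integrates to zero. -/
lemma integral_Ioi_line_eq_zero {φ : ℝ × ℝ → ℝ} (hφ : ContDiff ℝ 1 φ)
    (hsupp : HasCompactSupport φ) (a : ℝ) :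
    ∫ x in Set.Ioi (0 : ℝ),
      (φ (x, a * x)
        + x * (fderiv ℝ φ (x, a * x) (1, 0) + a * fderiv ℝ φ (x, a * x) (0, 1))) = 0 := by
  have hderiv (x : ℝ) : deriv (fun t : ℝ => t * φ (t, a * t)) x = φ (x, a * x)
      + x * (fderiv ℝ φ (x, a * x) (1, 0) + a * fderiv ℝ φ (x, a * x) (0, 1)) := by
    have hφx := hasDerivAt_comp_line (hφ.differentiable one_ne_zero (x, a * x))
    simpa using ((hasDerivAt_id' x).fun_mul hφx).deriv
  have hF : ContDiff ℝ 1 fun t : ℝ => t * φ (t, a * t) := by fun_prop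
  simpa [hderiv] using
    (hasCompactSupport_comp_line hsupp a).mul_left (f := fun t : ℝ => t)
      |>.integral_Ioi_deriv_eq hF 0

/-- Weak form of y-momentum conservation for the limiting measure solution
`m² = (x sin²θ cos θ)·δ_W`, `n² = (x sin³θ)·δ_W`, with boundary weight `w_p² = sin²θ cos θ`:
for `θ ∈ (0, π/2)`, `a = tan θ`, and every `C¹` compactly supported `φ : ℝ² → ℝ`,
`∫₀^∞ [sin²θ cos θ·x·∂ₓφ(x,ax) + sin³θ·x·∂_yφ(x,ax) + sin²θ cos θ·φ(x,ax)] dx = 0`. -/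
theorem limiting_measure_solution_y_momentum
    (θ a : ℝ) (hθ : θ ∈ Set.Ioo 0 (Real.pi / 2)) (ha : a = Real.tan θ)
    (φ : ℝ × ℝ → ℝ) (hφ : ContDiff ℝ 1 φ) (hsupp : HasCompactSupport φ) :
    ∫ x in Set.Ioi (0 : ℝ),
      (Real.sin θ ^ 2 * Real.cos θ * x * fderiv ℝ φ (x, a * x) (1, 0)
        + Real.sin θ ^ 3 * x * fderiv ℝ φ (x, a * x) (0, 1)
        + Real.sin θ ^ 2 * Real.cos θ * φ (x, a * x)) = 0 := by
  have hsin : Real.sin θ ^ 3 = Real.sin θ ^ 2 * Real.cos θ * a := by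
    have hcos : Real.cos θ ≠ 0 :=
      (Real.cos_pos_of_mem_Ioo ⟨by linarith [hθ.1, Real.pi_pos], hθ.2⟩).ne'
    rw [ha, Real.tan_eq_sin_div_cos]
    field_simp
  have h := congrArg (Real.sin θ ^ 2 * Real.cos θ * ·) (integral_Ioi_line_eq_zero hφ hsupp a)
  simp only [← integral_const_mul, mul_zero] at h
  rw [hsin]
  refine Eq.trans (integral_congr_ae (.of_forall fun x => ?_)) h
  dsimp only
  ring
end

section
/- One-dimensional hypersonic limit of the self-similar fluxes: let θ ∈ (0, π/2), a = tan θ, E₀' > 0, E₀ = E₀' + 1/2, and for small ε > 0 let (ρ₁^ε, u₁^ε, v₁^ε, p₁^ε, σ^ε, p₀^ε) be the shock-polar data. Define V^ε(η) for η ∈ [0, 1/a] by the upstream state (ρ, u, v, p) = (1, 1, 0, p₀^ε) for 0 ≤ η < 1/σ^ε and the downstream state (ρ₁^ε, u₁^ε, v₁^ε, p₁^ε) for 1/σ^ε < η ≤ 1/a. Then for every continuous φ : ℝ → ℝ: (i) ∫₀^{1/a} ρ^ε v^ε φ dη → φ(1/a); (ii) ∫₀^{1/a} ρ^ε u^ε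 v^ε φ dη → cos²θ·φ(1/a); (iii) ∫₀^{1/a} (ρ^ε (v^ε)² + p^ε) φ dη → sin θ cos θ·φ(1/a); (iv) ∫₀^{1/a} ρ^ε v^ε E₀ φ dη → E₀·φ(1/a), as ε → 0⁺. -/
open Filter Topology MeasureTheory

/-- Shock-polar root `u₁^ε = u(ε/(ε+2))`. -/
noncomputable def u1 (u : ℝ → ℝ) (ε : ℝ) : ℝ := u (ε / (ε + 2))

/-- Downstream velocity component `v₁^ε = a·u₁^ε`. -/
noncomputable def v1 (a : ℝ) (u : ℝ → ℝ) (ε : ℝ) : ℝ := a * u1 u ε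

/-- Shock slope `σ^ε = (1 − u₁^ε)/v₁^ε`. -/
noncomputable def sig (a : ℝ) (u : ℝ → ℝ) (ε : ℝ) : ℝ := (1 - u1 u ε) / v1 a u ε

/-- Shock angle `α^ε = arctan σ^ε`. -/
noncomputable def alph (a : ℝ) (u : ℝ → ℝ) (ε : ℝ) : ℝ := Real.arctan (sig a u ε)

/-- Downstream density `ρ₁^ε = ((ε+2)/ε)·sin²α^ε/(2E₀' + sin²α^ε)`. -/
noncomputable def rho1 (a E₀' : ℝ) (u : ℝ → ℝ) (ε : ℝ) : ℝ :=
  ((ε + 2) / ε) * Real.sin (alph a u ε) ^ 2 / (2 * E₀' + Real.sin (alph a u ε) ^ 2)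

/-- Downstream pressure `p₁^ε = (2(ε+1)sin²α^ε − ε²E₀')/((ε+1)(ε+2))`. -/
noncomputable def pr1 (a E₀' : ℝ) (u : ℝ → ℝ) (ε : ℝ) : ℝ :=
  (2 * (ε + 1) * Real.sin (alph a u ε) ^ 2 - ε ^ 2 * E₀') / ((ε + 1) * (ε + 2))

/-- Upstream pressure `p₀^ε = (ε/(ε+1))·E₀'`. -/
noncomputable def pr0 (E₀' : ℝ) (ε : ℝ) : ℝ := (ε / (ε + 1)) * E₀'

/-- Step profiles with a layer `[c, L]` shrinking to its right endpoint, of height `B` carrying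
asymptotic mass `K`, converge to the point mass `K δ_L`. -/
theorem tendsto_integral_step_mul {l : Filter ℝ} {A B c : ℝ → ℝ} {L K : ℝ} {φ : ℝ → ℝ}
    (hφ : Continuous φ) (hL : 0 < L) (hc : Tendsto c l (𝓝 L)) (hcL : ∀ᶠ ε in l, c ε < L)
    (hA : Tendsto A l (𝓝 0)) (hB : Tendsto (fun ε => B ε * (L - c ε)) l (𝓝 K)) :
    Tendsto (fun ε => ∫ η in Set.Ioo (0 : ℝ) L, (if η < c ε then A ε else B ε) * φ η)
      l (𝓝 (K * φ L)) := by
  have hint (x y : ℝ) : IntervalIntegrable φ volume x y := hφ.intervalIntegrable x y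
  have hderiv : HasDerivAt (fun x => ∫ η in (0 : ℝ)..x, φ η) (φ L) L :=
    intervalIntegral.integral_hasDerivAt_right (hint 0 L)
      (hφ.stronglyMeasurableAtFilter _ _) hφ.continuousAt
  have hslope : Tendsto (fun ε => slope (fun x => ∫ η in (0 : ℝ)..x, φ η) L (c ε)) l
      (𝓝 (φ L)) :=
    (hasDerivAt_iff_tendsto_slope.mp hderiv).comp
      (tendsto_nhdsWithin_iff.mpr ⟨hc, hcL.mono fun ε h => h.ne⟩)
  have hlim := (hA.mul (hderiv.continuousAt.tendsto.comp hc)).add (hB.mul hslope)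
  rw [zero_mul, zero_add] at hlim
  refine hlim.congr' ?_
  filter_upwards [hcL, hc.eventually (lt_mem_nhds hL)] with ε hε hpos
  have hleft : Set.EqOn (fun η => A ε * φ η) (fun η => (if η < c ε then A ε else B ε) * φ η)
      (Set.uIoo 0 (c ε)) := fun η hη => by
    rw [Set.uIoo_of_le hpos.le] at hη
    simp [hη.2]
  have hright : Set.EqOn (fun η => B ε * φ η) (fun η => (if η < c ε then A ε else B ε) * φ η)
      (Set.uIoo (c ε) L) := fun η hη => by
    rw [Set.uIoo_of_le hε.le] at hη
    simp [hη.1.le.not_gt]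
  rw [← integral_Ioc_eq_integral_Ioo, ← intervalIntegral.integral_of_le hL.le,
    ← intervalIntegral.integral_add_adjacent_intervals
      (((hint 0 (c ε)).const_mul (A ε)).congr_uIoo hleft)
      (((hint (c ε) L).const_mul (B ε)).congr_uIoo hright),
    ← intervalIntegral.integral_congr_uIoo hleft,
    ← intervalIntegral.integral_congr_uIoo hright,
    intervalIntegral.integral_const_mul, intervalIntegral.integral_const_mul,
    ← intervalIntegral.integral_interval_sub_left (hint 0 L) (hint 0 (c ε)), slope_def_field]
  have : c ε - L ≠ 0 := sub_ne_zero.mpr hε.ne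
  simp only [Function.comp_apply]
  field_simp
  ring

/-- On the shock polar the mass flux across the shock layer is exactly one. -/
theorem rho1_mul_v1_mul_sub_eq_one {a E₀' : ℝ} {u : ℝ → ℝ} {ε : ℝ} (ha : 0 < a) (hE : 0 < E₀')
    (hε : 0 < ε) (hu : 0 < u1 u ε) (hu' : u1 u ε < 1)
    (hH : (1 - u1 u ε) ^ 2 * (u1 u ε - ε / (ε + 2) - 2 * (ε / (ε + 2)) * E₀')
      - a ^ 2 * (u1 u ε) ^ 2 * (1 - u1 u ε + 2 * (ε / (ε + 2)) * E₀') = 0) :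
    0 < rho1 a E₀' u ε ∧ rho1 a E₀' u ε * v1 a u ε * (1 / a - 1 / sig a u ε) = 1 := by
  have hv : 0 < v1 a u ε := mul_pos ha hu
  have hs : 0 < sig a u ε := div_pos (sub_pos.mpr hu') hv
  have hsu : 1 - u1 u ε = sig a u ε * (a * u1 u ε) := by
    rw [sig, div_mul_eq_mul_div, eq_div_iff hv.ne']; rfl
  have hrho : rho1 a E₀' u ε
      = sig a u ε ^ 2 / (ε / (ε + 2) * (2 * E₀' * (1 + sig a u ε ^ 2) + sig a u ε ^ 2)) := by
    have h1 : Real.sin (alph a u ε) ^ 2 = sig a u ε ^ 2 / (1 + sig a u ε ^ 2) := by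
      rw [alph, Real.sin_arctan, div_pow, Real.sq_sqrt (by positivity)]
    rw [rho1, h1]
    field_simp
  have hlam : 0 < ε / (ε + 2) := by positivity
  rw [hrho, v1]
  generalize ε / (ε + 2) = lam at *
  generalize sig a u ε = s at *
  generalize u1 u ε = w at *
  refine ⟨by positivity, ?_⟩
  rw [hsu] at hH
  have hpolar : s * w * (s - a) = lam * (2 * E₀' * (1 + s ^ 2) + s ^ 2) := by
    have h : (a * w) ^ 2 * (s * w * (s - a) - lam * (2 * E₀' * (1 + s ^ 2) + s ^ 2)) = 0 := by
      linear_combination hH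
    have h0 : (a * w) ^ 2 ≠ 0 := by positivity
    linarith [(mul_eq_zero.mp h).resolve_left h0]
  rw [← hpolar]
  have hsa : s - a ≠ 0 := by
    rintro h
    rw [h, mul_zero] at hpolar
    exact absurd hpolar (by positivity)
  field_simp

/-- One-dimensional hypersonic limit of the self-similar fluxes. With
`θ ∈ (0, π/2)`, `a = tan θ`, `E₀' > 0`, `E₀ = E₀' + 1/2`, and `V^ε(η)` the self-similar
solution equal to the upstream state `(1, 1, 0, p₀^ε)` for `0 ≤ η < 1/σ^ε` and to the
downstream state `(ρ₁^ε, u₁^ε, v₁^ε, p₁^ε)` for `1/σ^ε < η ≤ 1/a`, for every continuous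
`φ : ℝ → ℝ`, as `ε → 0⁺`:
(i) `∫₀^{1/a} ρ^ε v^ε φ dη → φ(1/a)`;
(ii) `∫₀^{1/a} ρ^ε u^ε v^ε φ dη → cos²θ·φ(1/a)`;
(iii) `∫₀^{1/a} (ρ^ε (v^ε)² + p^ε) φ dη → sin θ cos θ·φ(1/a)`;
(iv) `∫₀^{1/a} ρ^ε v^ε E₀ φ dη → E₀·φ(1/a)`. -/
theorem hypersonic_limit_self_similar_fluxes
    (θ a E₀' E₀ lam₀ : ℝ) (hθ : θ ∈ Set.Ioo 0 (Real.pi / 2)) (ha : a = Real.tan θ)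
    (hE : 0 < E₀') (hE₀ : E₀ = E₀' + 1 / 2) (hlam₀ : 0 < lam₀)
    (u : ℝ → ℝ) (hu : ContDiffOn ℝ 1 u (Set.Ioo (-lam₀) lam₀))
    (hu0 : u 0 = Real.cos θ ^ 2)
    (huH : ∀ lam ∈ Set.Ioo (-lam₀) lam₀,
      (1 - u lam) ^ 2 * (u lam - lam - 2 * lam * E₀')
        - a ^ 2 * (u lam) ^ 2 * (1 - u lam + 2 * lam * E₀') = 0)
    (φ : ℝ → ℝ) (hφ : Continuous φ) :
    Tendsto (fun ε : ℝ =>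
        ∫ η in Set.Ioo (0 : ℝ) (1 / a),
          (if η < 1 / sig a u ε then 1 * 0 else rho1 a E₀' u ε * v1 a u ε) * φ η)
      (𝓝[>] 0) (𝓝 (φ (1 / a))) ∧
    Tendsto (fun ε : ℝ =>
        ∫ η in Set.Ioo (0 : ℝ) (1 / a),
          (if η < 1 / sig a u ε then 1 * 1 * 0 else rho1 a E₀' u ε * u1 u ε * v1 a u ε) * φ η)
      (𝓝[>] 0) (𝓝 (Real.cos θ ^ 2 * φ (1 / a))) ∧
    Tendsto (fun ε : ℝ =>
        ∫ η in Set.Ioo (0 : ℝ) (1 / a),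
          (if η < 1 / sig a u ε then 1 * 0 ^ 2 + pr0 E₀' ε
            else rho1 a E₀' u ε * (v1 a u ε) ^ 2 + pr1 a E₀' u ε) * φ η)
      (𝓝[>] 0) (𝓝 (Real.sin θ * Real.cos θ * φ (1 / a))) ∧
    Tendsto (fun ε : ℝ =>
        ∫ η in Set.Ioo (0 : ℝ) (1 / a),
          (if η < 1 / sig a u ε then 1 * 0 * E₀ else rho1 a E₀' u ε * v1 a u ε * E₀) * φ η)
      (𝓝[>] 0) (𝓝 (E₀ * φ (1 / a))) := by
  obtain ⟨hθ0, hθ1⟩ := hθ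
  have hcos : 0 < Real.cos θ := Real.cos_pos_of_mem_Ioo ⟨by linarith, hθ1⟩
  have hsin : 0 < Real.sin θ := Real.sin_pos_of_pos_of_lt_pi hθ0 (by linarith)
  have hsq := Real.sin_sq_add_cos_sq θ
  have hacos : a * Real.cos θ = Real.sin θ := by rw [ha, Real.tan_mul_cos hcos.ne']
  have ha0 : 0 < a := ha ▸ Real.tan_pos_of_pos_of_lt_pi_div_two hθ0 hθ1
  have hid : Tendsto (fun ε : ℝ => ε) (𝓝[>] 0) (𝓝 0) := nhdsWithin_le_nhds
  have hlam : Tendsto (fun ε : ℝ => ε / (ε + 2)) (𝓝[>] 0) (𝓝 0) := by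
    simpa [Pi.div_def] using hid.div (hid.add_const 2) (by norm_num)
  have hmem : Set.Ioo (-lam₀) lam₀ ∈ 𝓝 (0 : ℝ) := Ioo_mem_nhds (by linarith) hlam₀
  have hu1 : Tendsto (u1 u) (𝓝[>] 0) (𝓝 (Real.cos θ ^ 2)) :=
    hu0 ▸ (hu.continuousOn.continuousAt hmem).tendsto.comp hlam
  have hv1 : Tendsto (v1 a u) (𝓝[>] 0) (𝓝 (a * Real.cos θ ^ 2)) := hu1.const_mul a
  have hsig : Tendsto (sig a u) (𝓝[>] 0) (𝓝 a) := by
    have h : (1 - Real.cos θ ^ 2) / (a * Real.cos θ ^ 2) = a := by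
      rw [div_eq_iff (by positivity)]
      linear_combination -hsq - (a * Real.cos θ + Real.sin θ) * hacos
    have hdiv := (hu1.const_sub 1).div hv1 (by positivity)
    rwa [h] at hdiv
  have hinv : Tendsto (fun ε => 1 / sig a u ε) (𝓝[>] 0) (𝓝 (1 / a)) :=
    tendsto_const_nhds.div hsig ha0.ne'
  have hpolar : ∀ᶠ ε in 𝓝[>] (0 : ℝ), 0 < v1 a u ε ∧ 0 < rho1 a E₀' u ε ∧
      rho1 a E₀' u ε * v1 a u ε * (1 / a - 1 / sig a u ε) = 1 := by
    filter_upwards [self_mem_nhdsWithin, hlam.eventually hmem,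
      hu1.eventually (lt_mem_nhds (by positivity : 0 < Real.cos θ ^ 2)),
      hu1.eventually (gt_mem_nhds (by nlinarith : Real.cos θ ^ 2 < 1))] with ε hε hl hpos hlt
    exact ⟨mul_pos ha0 hpos,
      rho1_mul_v1_mul_sub_eq_one ha0 hE hε hpos hlt (huH _ hl)⟩
  have hmass : ∀ᶠ ε in 𝓝[>] (0 : ℝ),
      rho1 a E₀' u ε * v1 a u ε * (1 / a - 1 / sig a u ε) = 1 := hpolar.mono fun _ h => h.2.2
  have hlayer : ∀ᶠ ε in 𝓝[>] (0 : ℝ), 1 / sig a u ε < 1 / a := by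
    filter_upwards [hpolar] with ε ⟨hv, hr, h⟩
    have := pos_of_mul_pos_right (h ▸ one_pos) (mul_pos hr hv).le
    linarith
  have hpr0 : Tendsto (pr0 E₀') (𝓝[>] 0) (𝓝 0) := by
    simpa [show pr0 E₀' = fun ε => ε / (ε + 1) * E₀' from rfl] using
      (hid.div (hid.add_const 1) (by norm_num)).mul_const E₀'
  have hsin_alph : Tendsto (fun ε => Real.sin (alph a u ε) ^ 2) (𝓝[>] 0)
      (𝓝 (Real.sin (Real.arctan a) ^ 2)) :=
    ((Real.continuous_sin.comp Real.continuous_arctan).continuousAt.tendsto.comp hsig).pow 2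
  have hpr1 := ((((hid.add_const 1).const_mul 2).mul hsin_alph).sub
    ((hid.pow 2).mul_const E₀')).div ((hid.add_const 1).mul (hid.add_const 2)) (by norm_num)
  have hlim {A B : ℝ → ℝ} {K : ℝ} (hA : Tendsto A (𝓝[>] 0) (𝓝 0))
      (hB : Tendsto (fun ε => B ε * (1 / a - 1 / sig a u ε)) (𝓝[>] 0) (𝓝 K)) :=
    tendsto_integral_step_mul hφ (one_div_pos.mpr ha0) hinv hlayer hA hB
  refine ⟨?_, hlim (by simp) (hu1.congr' ?_), hlim (by simpa using hpr0) ?_,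
    hlim (by simp) (tendsto_const_nhds.congr' ?_)⟩
  · rw [← one_mul (φ (1 / a))]
    refine hlim (by simp) (tendsto_const_nhds.congr' ?_)
    filter_upwards [hmass] with ε h using h.symm
  · filter_upwards [hmass] with ε h
    linear_combination -u1 u ε * h
  · have h := hv1.add (hpr1.mul (hinv.const_sub (1 / a)))
    rw [sub_self, mul_zero, add_zero,
      show a * Real.cos θ ^ 2 = Real.sin θ * Real.cos θ by rw [← hacos]; ring] at h
    refine h.congr' ?_
    filter_upwards [hmass] with ε h
    simp only [pr1, Pi.div_apply]
    linear_combination -v1 a u ε * h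
  · filter_upwards [hmass] with ε h
    linear_combination -E₀ * h
end

section
/- Vague convergence of mass-flux measures in the hypersonic limit: let θ ∈ (0, π/2), a = tan θ, E₀' > 0, Ω = {(x,y) : x > 0, y > ax}, and for small ε > 0 define on Ω the piecewise-constant flow (ρ^ε, u^ε, v^ε)(x,y) equal to (1, 1, 0) when x/y < 1/σ^ε and equal to (ρ₁^ε, u₁^ε, v₁^ε) when x/y > 1/σ^ε, with the shock-polar data (ρ₁^ε, u₁^ε, v₁^ε, σ^ε). Then for every continuous ψ : ℝ² → ℝ with compact support: lim_{ε→0⁺} ∫_Ω ρ^ε u^ε ψ dx dy = ∫_Ω ψ dx dy + √(1+a²)·∫₀^∞ (sin θ)·x·ψ(x, ax) dx, and lim_{ε→0⁺} ∫_Ω ρ^ε v^ε ψ dx dy = √(1+a²)·∫₀^∞ (sin²θ/cos θ)·x·ψ(x, ax) dx. That is, ρ^ε u^ε·1_Ω L² → 1_Ω L² + (x sin θ)δ_W and ρ^ε v^ε·1_Ω L² → (x sin²θ/cos θ)δ_W vaguely as measures. -/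
open Filter Topology MeasureTheory

/-- The wedge `{0 < x, a x < y ≤ σ x}` between the rays of slopes `a` and `σ`. -/
def wedge (a σ : ℝ) : Set (ℝ × ℝ) := {q | 0 < q.1 ∧ a * q.1 < q.2 ∧ q.2 ≤ σ * q.1}

theorem measurableSet_wedge (a σ : ℝ) : MeasurableSet (wedge a σ) := by
  refine (measurableSet_lt measurable_const measurable_fst).inter
    ((measurableSet_lt (measurable_fst.const_mul a) measurable_snd).inter
      (measurableSet_le measurable_snd (measurable_fst.const_mul σ)))

theorem setIntegral_wedge {a σ : ℝ} (h : a ≤ σ) {ψ : ℝ × ℝ → ℝ} (hψ : Integrable ψ) :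
    ∫ q in wedge a σ, ψ q =
      (σ - a) * ∫ x in Set.Ioi (0 : ℝ), x * ∫ t in (0 : ℝ)..1, ψ (x, a * x + (σ - a) * x * t) := by
  rw [← integral_indicator (measurableSet_wedge a σ), Measure.volume_eq_prod,
    integral_prod _ (hψ.indicator (measurableSet_wedge a σ)), ← integral_const_mul,
    ← integral_indicator measurableSet_Ioi]
  refine integral_congr_ae (Eventually.of_forall fun x => ?_)
  by_cases hx : 0 < x
  · have hle : a * x ≤ σ * x := by gcongr
    have hind : (fun y => (wedge a σ).indicator ψ (x, y)) =
        (Set.Ioc (a * x) (σ * x)).indicator fun y => ψ (x, y) := by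
      ext y
      simp [Set.indicator, wedge, hx]
    have hsub := intervalIntegral.mul_integral_comp_add_mul (a := 0) (b := 1)
      (f := fun y => ψ (x, y)) ((σ - a) * x) (a * x)
    simp only [mul_zero, add_zero, mul_one] at hsub
    rw [show a * x + (σ - a) * x = σ * x by ring] at hsub
    simp only [hind, Set.indicator_of_mem (Set.mem_Ioi.2 hx)]
    rw [integral_indicator measurableSet_Ioc, ← intervalIntegral.integral_of_le hle, ← hsub]
    ring
  · simp [Set.indicator, wedge, hx]

theorem tendsto_setIntegral_wedge_average (a : ℝ) {ψ : ℝ × ℝ → ℝ} (hψ : Continuous ψ)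
    (hsupp : HasCompactSupport ψ) :
    Tendsto (fun h : ℝ =>
        ∫ x in Set.Ioi (0 : ℝ), x * ∫ t in (0 : ℝ)..1, ψ (x, a * x + h * x * t))
      (𝓝 0) (𝓝 (∫ x in Set.Ioi (0 : ℝ), x * ψ (x, a * x))) := by
  obtain ⟨R, hR, hzero⟩ : ∃ R : ℝ, 0 < R ∧ ∀ x y, R < x → ψ (x, y) = 0 := by
    obtain ⟨R, hR, hball⟩ := hsupp.isCompact.isBounded.subset_closedBall_lt 0 0
    refine ⟨R, hR, fun x y hx => ?_⟩
    by_contra hne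
    have hmem := hball (subset_tsupport ψ hne)
    rw [mem_closedBall_zero_iff] at hmem
    have h1 : ‖x‖ ≤ R := (norm_fst_le (x, y)).trans hmem
    exact absurd ((le_abs_self x).trans h1) (not_le.2 hx)
  have htrunc : ∀ h : ℝ,
      ∫ x in Set.Ioi (0 : ℝ), x * ∫ t in (0 : ℝ)..1, ψ (x, a * x + h * x * t) =
        ∫ x in (0 : ℝ)..R, x * ∫ t in (0 : ℝ)..1, ψ (x, a * x + h * x * t) := by
    intro h
    rw [intervalIntegral.integral_of_le hR.le]
    refine setIntegral_eq_of_subset_of_forall_sdiff_eq_zero measurableSet_Ioi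
      Set.Ioc_subset_Ioi_self fun x hx => ?_
    have hx' : R < x := by
      by_contra! hle
      exact hx.2 ⟨hx.1, hle⟩
    simp [hzero x _ hx']
  have hinner : Continuous fun p : ℝ × ℝ =>
      ∫ t in (0 : ℝ)..1, ψ (p.2, a * p.2 + p.1 * p.2 * t) :=
    intervalIntegral.continuous_parametric_intervalIntegral_of_continuous' (by fun_prop) 0 1
  have hcont : Continuous fun h : ℝ =>
      ∫ x in (0 : ℝ)..R, x * ∫ t in (0 : ℝ)..1, ψ (x, a * x + h * x * t) :=
    intervalIntegral.continuous_parametric_intervalIntegral_of_continuous'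
      (continuous_snd.mul hinner) 0 R
  simp only [← htrunc] at hcont
  simpa using hcont.tendsto 0

theorem setIntegral_two_state {a σ : ℝ} (ha : 0 < a) (h : a ≤ σ) (c k : ℝ) {ψ : ℝ × ℝ → ℝ}
    (hψ : Integrable ψ) :
    ∫ q in {q : ℝ × ℝ | 0 < q.1 ∧ a * q.1 < q.2}, (if q.1 / q.2 < 1 / σ then c else k) * ψ q =
      c * (∫ q in {q : ℝ × ℝ | 0 < q.1 ∧ a * q.1 < q.2}, ψ q) +
        (k - c) * ∫ q in wedge a σ, ψ q := by
  have hmeas : MeasurableSet {q : ℝ × ℝ | 0 < q.1 ∧ a * q.1 < q.2} :=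
    (measurableSet_lt measurable_const measurable_fst).inter
      (measurableSet_lt (measurable_fst.const_mul a) measurable_snd)
  have hsub : wedge a σ ⊆ {q : ℝ × ℝ | 0 < q.1 ∧ a * q.1 < q.2} := fun q hq => ⟨hq.1, hq.2.1⟩
  have hpt : Set.EqOn (fun q : ℝ × ℝ => (if q.1 / q.2 < 1 / σ then c else k) * ψ q)
      (fun q => c * ψ q + (k - c) * (wedge a σ).indicator ψ q)
      {q : ℝ × ℝ | 0 < q.1 ∧ a * q.1 < q.2} := by
    rintro ⟨x, y⟩ ⟨hx, hy⟩
    simp only at hx hy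
    have hy0 : 0 < y := (mul_pos ha hx).trans hy
    have hiff : x / y < 1 / σ ↔ σ * x < y := by
      rw [div_lt_div_iff₀ hy0 (ha.trans_le h), one_mul, mul_comm]
    by_cases hlt : σ * x < y
    · simp only [hiff, hlt, if_true, Set.indicator, wedge, Set.mem_ofPred_eq, not_le.2 hlt,
        and_false, if_false, mul_zero, add_zero]
    · have hle := not_lt.1 hlt
      simp only [hiff, hlt, if_false, Set.indicator, wedge, Set.mem_ofPred_eq, hx, hy, hle, and_self,
        if_true]
      ring
  rw [setIntegral_congr_fun hmeas hpt, integral_add (hψ.const_mul c).integrableOn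
    ((hψ.indicator (measurableSet_wedge a σ)).const_mul _).integrableOn,
    integral_const_mul, integral_const_mul, setIntegral_indicator (measurableSet_wedge a σ),
    Set.inter_eq_self_of_subset_right hsub]

/-- If the two-state interface tends to the boundary ray while the inner state blows up at the
reciprocal rate, the excess mass concentrates on the ray. -/
theorem tendsto_setIntegral_two_state {ι : Type*} {l : Filter ι} {a : ℝ} (ha : 0 < a)
    {σ k : ι → ℝ} {K : ℝ} (c : ℝ) (hσ : Tendsto σ l (𝓝 a)) (hlt : ∀ᶠ i in l, a < σ i)
    (hk : Tendsto (fun i => k i * (σ i - a)) l (𝓝 K)) {ψ : ℝ × ℝ → ℝ} (hψ : Continuous ψ)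
    (hsupp : HasCompactSupport ψ) :
    Tendsto (fun i => ∫ q in {q : ℝ × ℝ | 0 < q.1 ∧ a * q.1 < q.2},
        (if q.1 / q.2 < 1 / σ i then c else k i) * ψ q) l
      (𝓝 (c * (∫ q in {q : ℝ × ℝ | 0 < q.1 ∧ a * q.1 < q.2}, ψ q) +
        K * ∫ x in Set.Ioi (0 : ℝ), x * ψ (x, a * x))) := by
  have hint : Integrable ψ := hψ.integrable_of_hasCompactSupport hsupp
  have hdiff : Tendsto (fun i => σ i - a) l (𝓝 0) := by simpa using hσ.sub_const a
  have hcoef : Tendsto (fun i => k i * (σ i - a) - c * (σ i - a)) l (𝓝 K) := by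
    simpa using hk.sub (hdiff.const_mul c)
  refine ((hcoef.mul ((tendsto_setIntegral_wedge_average a hψ hsupp).comp hdiff)).const_add
    (c * ∫ q in {q : ℝ × ℝ | 0 < q.1 ∧ a * q.1 < q.2}, ψ q)).congr' ?_
  filter_upwards [hlt] with i hi
  rw [setIntegral_two_state ha hi.le c (k i) hint, setIntegral_wedge hi.le hint]
  simp only [Function.comp_apply]
  ring

/-- Implicit differentiation of the shock polar at the hypersonic limit. -/
theorem hasDerivAt_shock_polar {θ a E lam₀ : ℝ} (hs : 0 < Real.sin θ) (hc : 0 < Real.cos θ)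
    (ha : a = Real.tan θ) (hlam₀ : 0 < lam₀) {u : ℝ → ℝ} (hu : DifferentiableAt ℝ u 0)
    (hu0 : u 0 = Real.cos θ ^ 2)
    (huH : ∀ lam ∈ Set.Ioo (-lam₀) lam₀,
      (1 - u lam) ^ 2 * (u lam - lam - 2 * lam * E)
        - a ^ 2 * (u lam) ^ 2 * (1 - u lam + 2 * lam * E) = 0) :
    HasDerivAt u (-(Real.sin θ ^ 2 + 2 * E)) 0 := by
  have hd := hu.hasDerivAt
  set d := deriv u 0
  have hid := hasDerivAt_id (0 : ℝ)
  have h1 := (hd.const_sub 1).pow 2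
  have h2 := (hd.sub hid).sub ((hid.const_mul 2).mul_const E)
  have h3 := (hd.pow 2).const_mul (a ^ 2)
  have h4 := (hd.const_sub 1).add ((hid.const_mul 2).mul_const E)
  have hH := (h1.mul h2).sub (h3.mul h4)
  have hzero := hH.unique ((hasDerivAt_const (0 : ℝ) (0 : ℝ)).congr_of_eventuallyEq (by
    filter_upwards [Ioo_mem_nhds (neg_lt_zero.2 hlam₀) hlam₀] with x hx
    exact huH x hx))
  have hatan : a * Real.cos θ = Real.sin θ := by rw [ha, Real.tan_mul_cos hc.ne']
  have hsc := Real.sin_sq_add_cos_sq θ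
  simp only [Nat.cast_ofNat, Nat.add_one_sub_one, pow_one, Pi.sub_apply, Pi.pow_apply,
    Pi.add_apply, id_eq, mul_zero, zero_mul, sub_zero, add_zero, mul_one, hu0,
    show 1 - Real.cos θ ^ 2 = Real.sin θ ^ 2 by linarith] at hzero
  have hatan2 : a ^ 2 * Real.cos θ ^ 2 = Real.sin θ ^ 2 := by rw [← mul_pow, hatan]
  have hfactor : Real.sin θ ^ 2 * (d + Real.sin θ ^ 2 + 2 * E) = 0 := by
    linear_combination -hzero - (2 * d * Real.sin θ ^ 2 + Real.cos θ ^ 2 * (-d + 2 * E)) * hatan2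
      - Real.sin θ ^ 2 * (d + 2 * E) * hsc
  have hroot := (mul_eq_zero.1 hfactor).resolve_left (by positivity)
  rwa [show d = -(Real.sin θ ^ 2 + 2 * E) by linarith] at hd

/-- Vague convergence of the mass-flux measures in the hypersonic limit.
With `θ ∈ (0, π/2)`, `a = tan θ`, `E₀' > 0`, `Ω = {(x,y) : x > 0, y > ax}`, and
`(ρ^ε, u^ε, v^ε) = (1, 1, 0)` on `{x/y < 1/σ^ε}`, `= (ρ₁^ε, u₁^ε, v₁^ε)` on `{x/y > 1/σ^ε}`,
for every continuous compactly supported `ψ : ℝ² → ℝ`: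
`∫_Ω ρ^ε u^ε ψ → ∫_Ω ψ + √(1+a²)·∫₀^∞ sin θ·x·ψ(x, ax) dx`, and
`∫_Ω ρ^ε v^ε ψ → √(1+a²)·∫₀^∞ (sin²θ/cos θ)·x·ψ(x, ax) dx`, as `ε → 0⁺`; i.e.
`ρ^ε u^ε·1_Ω L² → 1_Ω L² + (x sin θ)δ_W` and `ρ^ε v^ε·1_Ω L² → (x sin²θ/cos θ)δ_W` vaguely. -/
theorem hypersonic_limit_mass_flux_vague_convergence
    (θ a E₀' lam₀ : ℝ) (hθ : θ ∈ Set.Ioo 0 (Real.pi / 2)) (ha : a = Real.tan θ)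
    (hE : 0 < E₀') (hlam₀ : 0 < lam₀)
    (u : ℝ → ℝ) (hu : ContDiffOn ℝ 1 u (Set.Ioo (-lam₀) lam₀))
    (hu0 : u 0 = Real.cos θ ^ 2)
    (huH : ∀ lam ∈ Set.Ioo (-lam₀) lam₀,
      (1 - u lam) ^ 2 * (u lam - lam - 2 * lam * E₀')
        - a ^ 2 * (u lam) ^ 2 * (1 - u lam + 2 * lam * E₀') = 0)
    (ψ : ℝ × ℝ → ℝ) (hψ : Continuous ψ) (hsupp : HasCompactSupport ψ) :
    Tendsto (fun ε : ℝ =>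
        ∫ q in {q : ℝ × ℝ | 0 < q.1 ∧ a * q.1 < q.2},
          (if q.1 / q.2 < 1 / sig a u ε then 1 * 1 else rho1 a E₀' u ε * u1 u ε) * ψ q)
      (𝓝[>] 0)
      (𝓝 ((∫ q in {q : ℝ × ℝ | 0 < q.1 ∧ a * q.1 < q.2}, ψ q)
        + Real.sqrt (1 + a ^ 2) *
            ∫ x in Set.Ioi (0 : ℝ), Real.sin θ * x * ψ (x, a * x))) ∧
    Tendsto (fun ε : ℝ =>
        ∫ q in {q : ℝ × ℝ | 0 < q.1 ∧ a * q.1 < q.2},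
          (if q.1 / q.2 < 1 / sig a u ε then 1 * 0 else rho1 a E₀' u ε * v1 a u ε) * ψ q)
      (𝓝[>] 0)
      (𝓝 (Real.sqrt (1 + a ^ 2) *
        ∫ x in Set.Ioi (0 : ℝ), (Real.sin θ ^ 2 / Real.cos θ) * x * ψ (x, a * x))) := by
  have hs : 0 < Real.sin θ := Real.sin_pos_of_pos_of_lt_pi hθ.1 (by linarith [hθ.2, Real.pi_pos])
  have hc : 0 < Real.cos θ := Real.cos_pos_of_mem_Ioo ⟨by linarith [hθ.1, Real.pi_pos], hθ.2⟩
  have ha0 : 0 < a := ha ▸ Real.tan_pos_of_pos_of_lt_pi_div_two hθ.1 hθ.2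
  have hatan : a = Real.sin θ / Real.cos θ := by rw [ha, Real.tan_eq_sin_div_cos]
  have hsc := Real.sin_sq_add_cos_sq θ
  have hd : HasDerivAt u (-(Real.sin θ ^ 2 + 2 * E₀')) 0 :=
    hasDerivAt_shock_polar hs hc ha hlam₀
      ((hu.differentiableOn one_ne_zero).differentiableAt
        (Ioo_mem_nhds (neg_lt_zero.2 hlam₀) hlam₀)) hu0 huH
  set D : ℝ := (Real.sin θ ^ 2 + 2 * E₀') / (a * Real.cos θ ^ 4) with hD
  have hDpos : 0 < D := by positivity
  have hslope : HasDerivAt (fun lam => (1 - u lam) / (a * u lam)) D 0 := by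
    refine ((hd.const_sub 1).div (hd.const_mul a) (by rw [hu0]; positivity)).congr_deriv ?_
    rw [hu0, hD]
    field_simp
    ring
  have hslope0 : (1 - u 0) / (a * u 0) = a := by
    rw [hu0, ← hsc, hatan]
    field_simp
    ring
  have hlam : Tendsto (fun ε : ℝ => ε / (ε + 2)) (𝓝[>] 0) (𝓝[>] 0) := by
    refine tendsto_nhdsWithin_iff.2 ⟨?_, ?_⟩
    · have h : ContinuousAt (fun ε : ℝ => ε / (ε + 2)) 0 := by
        fun_prop (disch := norm_num)
      simpa using h.tendsto.mono_left nhdsWithin_le_nhds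
    · filter_upwards [self_mem_nhdsWithin] with ε hε
      have : (0 : ℝ) < ε := hε
      exact Set.mem_Ioi.2 (by positivity)
  have hu1 : Tendsto (u1 u) (𝓝[>] 0) (𝓝 (Real.cos θ ^ 2)) :=
    hu0 ▸ hd.continuousAt.tendsto.comp (hlam.mono_right nhdsWithin_le_nhds)
  have hsig : Tendsto (sig a u) (𝓝[>] 0) (𝓝 a) := by
    have h := hslope.continuousAt.tendsto.comp (hlam.mono_right nhdsWithin_le_nhds)
    rwa [hslope0] at h
  have hquot : Tendsto (fun ε => (ε / (ε + 2))⁻¹ * (sig a u ε - a)) (𝓝[>] 0) (𝓝 D) := by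
    have h := hslope.tendsto_slope_zero_right.comp hlam
    simpa [Function.comp_def, hslope0, sig, v1, u1] using h
  have hlt : ∀ᶠ ε in 𝓝[>] (0 : ℝ), a < sig a u ε := by
    filter_upwards [hquot.eventually_const_lt hDpos, self_mem_nhdsWithin] with ε hε hε0
    have : (0 : ℝ) < ε := hε0
    exact sub_pos.1 (pos_of_mul_pos_right hε (by positivity))
  have hsin : Tendsto (fun ε => Real.sin (alph a u ε)) (𝓝[>] 0) (𝓝 (Real.sin θ)) := by
    have h := (Real.continuous_sin.comp Real.continuous_arctan).continuousAt.tendsto.comp hsig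
    have hth : Real.arctan a = θ := by
      rw [ha, Real.arctan_tan (by linarith [hθ.1, Real.pi_pos]) hθ.2]
    simpa [Function.comp_def, alph, hth] using h
  have hrho : Tendsto (fun ε => rho1 a E₀' u ε * (sig a u ε - a)) (𝓝[>] 0)
      (𝓝 (Real.sin θ / Real.cos θ ^ 3)) := by
    have h := ((hsin.pow 2).div ((hsin.pow 2).const_add (2 * E₀')) (by positivity)).mul hquot
    have hlim : Real.sin θ ^ 2 / (2 * E₀' + Real.sin θ ^ 2) * D = Real.sin θ / Real.cos θ ^ 3 := by
      rw [hD, hatan]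
      field_simp
      ring
    rw [hlim] at h
    refine h.congr fun ε => ?_
    simp only [rho1, inv_div, Pi.div_apply]
    ring
  have hsqrt : √(1 + a ^ 2) = 1 / Real.cos θ := by
    rw [show 1 + a ^ 2 = (1 / Real.cos θ) ^ 2 by
      rw [hatan]; field_simp; linarith, Real.sqrt_sq (by positivity)]
  constructor
  · have hk : Tendsto (fun ε => rho1 a E₀' u ε * u1 u ε * (sig a u ε - a)) (𝓝[>] 0)
        (𝓝 (Real.sin θ / Real.cos θ)) := by
      have h := hrho.mul hu1
      rw [show Real.sin θ / Real.cos θ ^ 3 * Real.cos θ ^ 2 = Real.sin θ / Real.cos θ by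
        field_simp] at h
      exact h.congr fun ε => by ring
    convert tendsto_setIntegral_two_state ha0 (1 * 1) hsig hlt hk hψ hsupp using 2
    simp_rw [mul_assoc (Real.sin θ)]
    rw [integral_const_mul, hsqrt]
    ring
  · have hk : Tendsto (fun ε => rho1 a E₀' u ε * v1 a u ε * (sig a u ε - a)) (𝓝[>] 0)
        (𝓝 (Real.sin θ ^ 2 / Real.cos θ ^ 2)) := by
      have h := hrho.mul (hu1.const_mul a)
      rw [show Real.sin θ / Real.cos θ ^ 3 * (a * Real.cos θ ^ 2) =
        Real.sin θ ^ 2 / Real.cos θ ^ 2 by rw [hatan]; field_simp] at h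
      exact h.congr fun ε => by simp only [v1]; ring
    convert tendsto_setIntegral_two_state ha0 (1 * 0) hsig hlt hk hψ hsupp using 2
    simp_rw [mul_assoc (Real.sin θ ^ 2 / Real.cos θ)]
    rw [integral_const_mul, hsqrt, mul_zero, zero_mul, zero_add, ← mul_assoc]
    congr 1
    field_simp
end
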